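/- Let ε be a real number with 0 < ε < 1, and let D_1, D_2, D_3 ⊆ ℝ² be the closed disks of radius ε/12 centered at the points (0,0), (1+ε/6, 0) and (2+ε/3, 0), respectively. Let S = R ∪ B ∪ Z be a finite set of points with R ⊆ D_1 nonempty, B ⊆ D_2 nonempty and Z ⊆ D_3, and consider the complete k-partite geometric graph K on S with k = |Z| + 2, whose color classes are R, B, and a singleton class {z} for each z ∈ Z. Let r ∈ R and b ∈ B, and let E be any subset of the edges of K with {r, b} ∉ E. Then δ_E(r, b) ≥ 3, and consequently δ_E(r, b) ≥ (3 − ε)·|rb|. -/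

import Mathlib

open scoped ENNReal

/-- The length of a walk, given as the list of its vertices. -/
noncomputable def walkLen {P : Type*} [PseudoEMetricSpace P] (xs : List P) : ℝ≥0∞ :=
  (List.zipWith edist xs xs.tail).sum

/-- `xs` is a walk from `p` to `q` in the graph with edge set `E`. -/
def IsWalk {P : Type*} (E : Set (Sym2 P)) (p q : P) (xs : List P) : Prop :=
  xs.head? = some p ∧ xs.getLast? = some q ∧ xs.Chain' (fun a b => s(a, b) ∈ E)

/-- Graph distance: the infimum of lengths of walks from `p` to `q`. -/
noncomputable def gdist {P : Type*} [PseudoEMetricSpace P] (E : Set (Sym2 P)) (p q : P) :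
    ℝ≥0∞ :=
  ⨅ (xs : List P) (_ : IsWalk E p q xs), walkLen xs

/-- A point of the Euclidean plane given by its two coordinates. -/
noncomputable def pt (x y : ℝ) : EuclideanSpace ℝ (Fin 2) :=
  (WithLp.equiv 2 (Fin 2 → ℝ)).symm ![x, y]

theorem le_walkLen_add_of_edge_le {P : Type*} [PseudoEMetricSpace P] {E : Set (Sym2 P)}
    {f : P → ℝ≥0∞} (hf : ∀ a c, s(a, c) ∈ E → f a ≤ edist a c + f c) {q : P} :
    ∀ {xs : List P} {p : P}, IsWalk E p q xs → f p ≤ walkLen xs + f q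
  | [], p, h => by simp [IsWalk] at h
  | [x], p, h => by
    obtain ⟨h1, h2, -⟩ := h
    simp only [List.head?_cons, List.getLast?_singleton, Option.some.injEq] at h1 h2
    subst h1 h2
    simp
  | x :: y :: l, p, h => by
    obtain ⟨h1, h2, h3⟩ := h
    simp only [List.head?_cons, Option.some.injEq] at h1
    subst h1
    rw [List.Chain', List.isChain_cons_cons] at h3
    have ih := le_walkLen_add_of_edge_le hf (q := q) (xs := y :: l) (p := y)
      ⟨rfl, by simpa using h2, h3.2⟩
    calc f x ≤ edist x y + f y := hf x y h3.1
      _ ≤ edist x y + (walkLen (y :: l) + f q) := by gcongr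
      _ = walkLen (x :: y :: l) + f q := by simp [walkLen, add_assoc]

theorem le_gdist_of_edge_le {P : Type*} [PseudoEMetricSpace P] {E : Set (Sym2 P)}
    {f : P → ℝ≥0∞} (hf : ∀ a c, s(a, c) ∈ E → f a ≤ edist a c + f c) (p : P) {q : P}
    (hq : f q = 0) : f p ≤ gdist E p q :=
  le_iInf₂ fun xs h => by simpa [hq] using le_walkLen_add_of_edge_le hf h

theorem dist_pt_zero (a c : ℝ) : dist (pt a 0) (pt c 0) = |a - c| := by
  simp [pt, EuclideanSpace.dist_eq, Real.dist_eq, Real.sqrt_sq_eq_abs]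

theorem sub_le_dist_of_mem_closedBall {a c ρ : ℝ} {x y : EuclideanSpace ℝ (Fin 2)}
    (hx : x ∈ Metric.closedBall (pt a 0) ρ) (hy : y ∈ Metric.closedBall (pt c 0) ρ) :
    c - a - 2 * ρ ≤ dist x y := by
  have h1 := dist_triangle4 (pt a 0) x y (pt c 0)
  rw [Metric.mem_closedBall] at hx hy
  rw [dist_pt_zero, dist_comm _ x] at h1
  linarith [neg_abs_le (a - c)]

theorem dist_le_of_mem_closedBall {a c ρ : ℝ} (hac : a ≤ c) {x y : EuclideanSpace ℝ (Fin 2)}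
    (hx : x ∈ Metric.closedBall (pt a 0) ρ) (hy : y ∈ Metric.closedBall (pt c 0) ρ) :
    dist x y ≤ c - a + 2 * ρ := by
  have h1 := dist_triangle4 x (pt a 0) (pt c 0) y
  rw [Metric.mem_closedBall] at hx hy
  rw [dist_pt_zero, dist_comm (pt c 0) y, abs_sub_comm, abs_of_nonneg (sub_nonneg.2 hac)] at h1
  linarith

/-- In the three-disk construction (`R` red points in `D₁`, `B` blue points in
`D₂`, the points of `Z` in `D₃`, each of the latter forming its own color
class), if a subgraph of the complete multipartite graph omits the edge
`{r, b}` with `r ∈ R`, `b ∈ B`, then `δ_E(r,b) ≥ 3`, and hence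
`δ_E(r,b) ≥ (3 − ε)·|rb|`. -/
theorem three_disks_detour (ε : ℝ) (hε0 : 0 < ε) (hε1 : ε < 1)
    (R B Z : Set (EuclideanSpace ℝ (Fin 2)))
    (hR : R ⊆ Metric.closedBall (pt 0 0) (ε / 12))
    (hB : B ⊆ Metric.closedBall (pt (1 + ε / 6) 0) (ε / 12))
    (hZ : Z ⊆ Metric.closedBall (pt (2 + ε / 3) 0) (ε / 12))
    (hRne : R.Nonempty) (hBne : B.Nonempty)
    (hfin : (R ∪ B ∪ Z).Finite)
    (r b : EuclideanSpace ℝ (Fin 2)) (hr : r ∈ R) (hb : b ∈ B)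
    (E : Set (Sym2 (EuclideanSpace ℝ (Fin 2))))
    (hE : E ⊆ {e | ∃ p q : EuclideanSpace ℝ (Fin 2), e = s(p, q) ∧
        p ∈ R ∪ B ∪ Z ∧ q ∈ R ∪ B ∪ Z ∧ p ≠ q ∧
        ¬(p ∈ R ∧ q ∈ R) ∧ ¬(p ∈ B ∧ q ∈ B)})
    (hrb : s(r, b) ∉ E) :
    (3 : ℝ≥0∞) ≤ gdist E r b ∧
      ENNReal.ofReal ((3 - ε) * dist r b) ≤ gdist E r b := by
  classical
  have far {n : ℕ} {x y : EuclideanSpace ℝ (Fin 2)} (h : (n : ℝ) ≤ dist x y) :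
      (n : ℝ≥0∞) ≤ edist x y := by
    rw [edist_dist, ← ENNReal.ofReal_natCast]
    exact ENNReal.ofReal_le_ofReal h
  have hRB {x y} (hx : x ∈ R) (hy : y ∈ B) : 1 ≤ edist x y := by
    have := sub_le_dist_of_mem_closedBall (hR hx) (hB hy)
    exact_mod_cast far (n := 1) (by push_cast; linarith)
  have hBZ {x y} (hx : x ∈ B) (hy : y ∈ Z) : 1 ≤ edist x y := by
    have := sub_le_dist_of_mem_closedBall (hB hx) (hZ hy)
    exact_mod_cast far (n := 1) (by push_cast; linarith)
  have hRZ {x y} (hx : x ∈ R) (hy : y ∈ Z) : 2 ≤ edist x y := by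
    have := sub_le_dist_of_mem_closedBall (hR hx) (hZ hy)
    exact_mod_cast far (n := 2) (by push_cast; linarith)
  have hRB' {x} (hx : x ∈ R) : x ∉ B := fun h => by simpa using hRB hx h
  have hBZ' {x} (hx : x ∈ Z) : x ∉ B := fun h => by simpa using hBZ h hx
  have hRZ' {x} (hx : x ∈ Z) : x ∉ R := fun h => by simpa using hRZ h hx
  -- A lower bound for the graph distance to `b`, compatible with all edges
  let f : EuclideanSpace ℝ (Fin 2) → ℝ≥0∞ := fun x =>
    if x = b then 0 else if x ∈ B then 2 else if x = r then 3 else 1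
  have fb : f b = 0 := by simp [f]
  have fr : f r = 3 := by simp [f, hRB' hr, ne_of_mem_of_not_mem hb (hRB' hr) |>.symm]
  have fZ {x} (hx : x ∈ Z) : f x = 1 := by
    simp [f, hBZ' hx, (ne_of_mem_of_not_mem hb (hBZ' hx)).symm,
      (ne_of_mem_of_not_mem hr (hRZ' hx)).symm]
  have fB {x} (hx : x ∈ B) (hxb : x ≠ b) : f x = 2 := by simp [f, hx, hxb]
  have fR {x} (hx : x ∈ R) (hxr : x ≠ r) : f x = 1 := by
    simp [f, hRB' hx, hxr, (ne_of_mem_of_not_mem hb (hRB' hx)).symm]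
  have key_RB {x y} (hx : x ∈ R) (hy : y ∈ B) (h : s(x, y) ∈ E) :
      f x ≤ edist x y + f y ∧ f y ≤ edist x y + f x := by
    have h1 := hRB hx hy
    by_cases hxr : x = r <;> by_cases hyb : y = b
    · subst hxr hyb; exact absurd h hrb
    · subst hxr
      rw [fr, fB hy hyb]
      exact ⟨le_trans (by norm_num) (add_le_add_left h1 2),
        le_trans (by norm_num) (add_le_add_left h1 3)⟩
    · subst hyb
      rw [fb, fR hx hxr]
      exact ⟨by simpa using h1, zero_le⟩
    · rw [fR hx hxr, fB hy hyb]
      exact ⟨le_trans (by norm_num) (add_le_add_left h1 2),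
        le_trans (by norm_num) (add_le_add_left h1 1)⟩
  have key_RZ {x y} (hx : x ∈ R) (hy : y ∈ Z) :
      f x ≤ edist x y + f y ∧ f y ≤ edist x y + f x := by
    have h1 := hRZ hx hy
    rw [fZ hy]
    by_cases hxr : x = r
    · subst hxr
      rw [fr]
      exact ⟨le_trans (by norm_num) (add_le_add_left h1 1),
        le_trans (by norm_num) (add_le_add_left h1 3)⟩
    · rw [fR hx hxr]
      exact ⟨le_add_self, le_add_self⟩
  have key_BZ {x y} (hx : x ∈ B) (hy : y ∈ Z) :
      f x ≤ edist x y + f y ∧ f y ≤ edist x y + f x := by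
    have h1 := hBZ hx hy
    rw [fZ hy]
    by_cases hxb : x = b
    · subst hxb
      rw [fb]
      exact ⟨zero_le, by simpa using h1⟩
    · rw [fB hx hxb]
      exact ⟨le_trans (by norm_num) (add_le_add_left h1 1),
        le_trans (by norm_num) (add_le_add_left h1 2)⟩
  have key (x y) (h : s(x, y) ∈ E) : f x ≤ edist x y + f y := by
    have hxy : (x ∈ R ∪ B ∪ Z) ∧ (y ∈ R ∪ B ∪ Z) ∧
        ¬(x ∈ R ∧ y ∈ R) ∧ ¬(x ∈ B ∧ y ∈ B) := by
      obtain ⟨p, q, e, hp, hq, -, h1, h2⟩ := hE h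
      rcases Sym2.eq_iff.1 e with ⟨rfl, rfl⟩ | ⟨rfl, rfl⟩
      · exact ⟨hp, hq, h1, h2⟩
      · exact ⟨hq, hp, fun t => h1 t.symm, fun t => h2 t.symm⟩
    obtain ⟨(hx | hx) | hx, (hy | hy) | hy, h1, h2⟩ := hxy
    · exact absurd ⟨hx, hy⟩ h1
    · exact (key_RB hx hy h).1
    · exact (key_RZ hx hy).1
    · rw [edist_comm]; exact (key_RB hy hx (Sym2.eq_swap ▸ h)).2
    · exact absurd ⟨hx, hy⟩ h2
    · exact (key_BZ hx hy).1
    · rw [edist_comm]; exact (key_RZ hy hx).2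
    · rw [edist_comm]; exact (key_BZ hy hx).2
    · rw [fZ hx, fZ hy]; exact le_add_self
  have main : (3 : ℝ≥0∞) ≤ gdist E r b := fr ▸ le_gdist_of_edge_le key r fb
  refine ⟨main, le_trans ?_ main⟩
  have hd := dist_le_of_mem_closedBall (by linarith) (hR hr) (hB hb)
  rw [show (3 : ℝ≥0∞) = ENNReal.ofReal 3 by simp]
  refine ENNReal.ofReal_le_ofReal ?_
  nlinarith [mul_le_mul_of_nonneg_left hd (by linarith : (0 : ℝ) ≤ 3 - ε), sq_nonneg ε]
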